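/- For any non-complete simple graph G of order n and any real x < 0, P'(G, x)/P(G, x) < ∑_{i=0}^{n−1} 1/(x − i). -/

import Mathlib

open Polynomial

/-- `P` is the chromatic polynomial of `G`: for every natural number `k`,
`P` evaluated at `k` equals the number of proper `k`-colorings of `G`. -/
def IsChromPoly {W : Type*} (G : SimpleGraph W) (P : Polynomial ℝ) : Prop :=
  ∀ k : ℕ, P.eval (k : ℝ) = (Nat.card (G.Coloring (Fin k)) : ℝ)

lemma Polynomial.eq_of_eval_natCast_eq {p q : ℝ[X]}
    (h : ∀ k : ℕ, p.eval (k : ℝ) = q.eval (k : ℝ)) : p = q :=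
  Polynomial.eq_of_infinite_eval_eq p q <|
    (Set.infinite_range_of_injective Nat.cast_injective).mono <| by
      rintro _ ⟨k, rfl⟩
      exact h k

section SetFunctions

variable {V : Type*} [DecidableEq V]

lemma sum_powerset_sum_powerset_sdiff (F : Finset V → Finset V → ℝ) (S : Finset V) :
    ∑ I ∈ S.powerset, ∑ J ∈ (S \ I).powerset, F I J =
      ∑ K ∈ S.powerset, ∑ I ∈ K.powerset, F I (K \ I) := by
  rw [Finset.sum_sigma', Finset.sum_sigma']
  refine Finset.sum_bij' (fun p _ => ⟨p.1 ∪ p.2, p.1⟩) (fun p _ => ⟨p.2, p.1 \ p.2⟩)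
    ?_ ?_ ?_ ?_ ?_
  · rintro ⟨I, J⟩ h
    simp only [Finset.mem_sigma, Finset.mem_powerset] at h ⊢
    exact ⟨Finset.union_subset h.1 (h.2.trans Finset.sdiff_subset), Finset.subset_union_left⟩
  · rintro ⟨K, I⟩ h
    simp only [Finset.mem_sigma, Finset.mem_powerset] at h ⊢
    exact ⟨h.2.trans h.1, Finset.sdiff_subset_sdiff h.1 le_rfl⟩
  · rintro ⟨I, J⟩ h
    simp only [Finset.mem_sigma, Finset.mem_powerset] at h
    have hd := Finset.union_sdiff_cancel_left
      (Finset.disjoint_of_subset_right h.2 Finset.disjoint_sdiff)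
    simp only [hd]
  · rintro ⟨K, I⟩ h
    simp only [Finset.mem_sigma, Finset.mem_powerset] at h
    simp only [Finset.union_sdiff_of_subset h.2]
  · rintro ⟨I, J⟩ h
    simp only [Finset.mem_sigma, Finset.mem_powerset] at h
    have hd := Finset.union_sdiff_cancel_left
      (Finset.disjoint_of_subset_right h.2 Finset.disjoint_sdiff)
    simp only [hd]

/-- The convolution of set functions over the decompositions `S = T ⊔ (S \ T)`. -/
def subsetConv (f g : Finset V → ℝ) (S : Finset V) : ℝ :=
  ∑ T ∈ S.powerset, f T * g (S \ T)

lemma subsetConv_assoc (f g h : Finset V → ℝ) :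
    subsetConv (subsetConv f g) h = subsetConv f (subsetConv g h) := by
  funext S
  have := sum_powerset_sum_powerset_sdiff (fun I J => f I * (g J * h (S \ (I ∪ J)))) S
  simp only [subsetConv, Finset.mul_sum, Finset.sum_mul, sdiff_sdiff_left, Finset.sup_eq_union]
  rw [this]
  refine Finset.sum_congr rfl fun K _ => Finset.sum_congr rfl fun I hI => ?_
  rw [Finset.union_sdiff_of_subset (Finset.mem_powerset.1 hI), mul_assoc]

lemma subsetConv_comm (f g : Finset V → ℝ) : subsetConv f g = subsetConv g f := by
  funext S
  refine Finset.sum_bij' (fun T _ => S \ T) (fun T _ => S \ T) ?_ ?_ ?_ ?_ ?_ <;>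
    simp +contextual [Finset.mem_powerset, mul_comm]

lemma subsetConv_smul (r : ℝ) (f g : Finset V → ℝ) :
    subsetConv f (r • g) = r • subsetConv f g := by
  funext S
  simp [subsetConv, Finset.mul_sum, mul_left_comm]

/-- The restriction of a set function to the sets containing `v`. -/
def rooted (v : V) (f : Finset V → ℝ) (S : Finset V) : ℝ :=
  if v ∈ S then f S else 0

lemma rooted_subsetConv (v : V) (f g : Finset V → ℝ) :
    rooted v (subsetConv f g) = subsetConv (rooted v f) g + subsetConv f (rooted v g) := by
  funext S
  by_cases hv : v ∈ S
  · simp only [Pi.add_apply, subsetConv, ← Finset.sum_add_distrib, rooted, if_pos hv]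
    refine Finset.sum_congr rfl fun T _ => ?_
    by_cases hT : v ∈ T <;> simp [hT, hv]
  · simp only [Pi.add_apply, subsetConv, ← Finset.sum_add_distrib, rooted, if_neg hv]
    refine (Finset.sum_eq_zero fun T hT => ?_).symm
    have : v ∉ T := fun h => hv (Finset.mem_powerset.1 hT h)
    simp [hv, this]

lemma subsetConv_rooted_of_notMem {v : V} {S : Finset V} (hv : v ∉ S) (f g : Finset V → ℝ) :
    subsetConv (rooted v f) g S = 0 :=
  Finset.sum_eq_zero fun T hT => by
    rw [rooted, if_neg fun h => hv (Finset.mem_powerset.1 hT h), zero_mul]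

lemma sum_powerset_nonempty_subset_neg_one_pow (K X : Finset V) :
    (∑ I ∈ K.powerset, if I.Nonempty ∧ I ⊆ X then (-1 : ℝ) ^ I.card else 0) =
      (if Disjoint K X then 1 else 0) - 1 := by
  have h1 : (∑ I ∈ K.powerset, if I ⊆ X then (-1 : ℝ) ^ I.card else 0) =
      if Disjoint K X then 1 else 0 := by
    rw [← Finset.sum_filter]
    have : K.powerset.filter (· ⊆ X) = (K ∩ X).powerset := by
      ext I; simp only [Finset.mem_filter, Finset.mem_powerset, Finset.subset_inter_iff]
    have h := congrArg (Int.cast (R := ℝ)) (Finset.sum_powerset_neg_one_pow_card (x := K ∩ X))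
    push_cast at h
    rw [this, h]
    simp only [Finset.disjoint_iff_inter_eq_empty]
  have h2 : (∑ I ∈ K.powerset, if I = ∅ then (1 : ℝ) else 0) = 1 := by simp
  rw [← h1, ← h2, ← Finset.sum_sub_distrib]
  refine Finset.sum_congr rfl fun I _ => ?_
  rcases I.eq_empty_or_nonempty with rfl | hI
  · simp
  · simp [hI, hI.ne_empty]

lemma sum_powerset_sum_mem (F : V → Finset V → ℝ) (S : Finset V) :
    ∑ T ∈ S.powerset, ∑ w ∈ T, F w (T.erase w) = ∑ w ∈ S, ∑ T ∈ (S.erase w).powerset, F w T := by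
  rw [Finset.sum_sigma', Finset.sum_sigma']
  refine Finset.sum_bij' (fun p _ => ⟨p.2, p.1.erase p.2⟩) (fun p _ => ⟨insert p.1 p.2, p.1⟩)
    ?_ ?_ ?_ ?_ ?_
  · rintro ⟨T, w⟩ h
    simp only [Finset.mem_sigma, Finset.mem_powerset] at h ⊢
    exact ⟨h.1 h.2, Finset.erase_subset_erase _ h.1⟩
  · rintro ⟨w, T⟩ h
    simp only [Finset.mem_sigma, Finset.mem_powerset] at h ⊢
    exact ⟨Finset.insert_subset h.1 (h.2.trans (Finset.erase_subset _ _)),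
      Finset.mem_insert_self _ _⟩
  · rintro ⟨T, w⟩ h
    simp only [Finset.mem_sigma] at h
    simp only [Finset.insert_erase h.2]
  · rintro ⟨w, T⟩ h
    simp only [Finset.mem_sigma, Finset.mem_powerset] at h
    simp only [Finset.erase_insert fun hw => Finset.notMem_erase w S (h.2 hw)]
  · rintro ⟨T, w⟩ _
    rfl

end SetFunctions

section ChromaticPolynomial

open scoped Classical in
/-- The vertices with a neighbor in `I`. -/
noncomputable def neighbors {V : Type*} [Fintype V] (G : SimpleGraph V) (I : Finset V) : Finset V :=
  {w | ∃ v ∈ I, G.Adj v w}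

lemma mem_neighbors {V : Type*} [Fintype V] {G : SimpleGraph V} {I : Finset V} {w : V} :
    w ∈ neighbors G I ↔ ∃ v ∈ I, G.Adj v w := by
  simp [neighbors]

lemma card_filter_last_eq_card_image {V : Type*} [LinearOrder V] (N : Finset V) (f : V → ℕ)
    [DecidablePred fun v => ∀ w ∈ N, v < w → f w ≠ f v] :
    {v ∈ N | ∀ w ∈ N, v < w → f w ≠ f v}.card = (N.image f).card := by
  rw [← Finset.card_image_of_injOn (s := {v ∈ N | ∀ w ∈ N, v < w → f w ≠ f v}) (f := f)]
  · congr 1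
    refine (Finset.image_subset_image (Finset.filter_subset _ _)).antisymm ?_
    intro c hc
    obtain ⟨v, hv, rfl⟩ := Finset.mem_image.1 hc
    have hne : {w ∈ N | f w = f v}.Nonempty := ⟨v, by simp [hv]⟩
    have hm := Finset.mem_filter.1 (Finset.max'_mem _ hne)
    refine Finset.mem_image.2 ⟨_, Finset.mem_filter.2 ⟨hm.1, fun w hw hlt h => ?_⟩, hm.2⟩
    exact absurd (Finset.le_max' _ w (Finset.mem_filter.2 ⟨hw, h.trans hm.2⟩)) (not_le.2 hlt)
  · intro v hv w hw h
    simp only [Finset.coe_filter, Set.mem_ofPred_eq] at hv hw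
    rcases lt_trichotomy v w with hlt | rfl | hlt
    · exact absurd h.symm (hv.2 w hw.1 hlt)
    · rfl
    · exact absurd h (hw.2 v hv.1 hlt)

variable {V : Type*} [Fintype V] [LinearOrder V]

open scoped Classical in
/-- Proper colorings of `G[S]` with colors `1, …, k`, extended by `0` outside `S`. -/
noncomputable def properColorings (G : SimpleGraph V) (S : Finset V) (k : ℕ) :
    Finset (V → ℕ) :=
  {f ∈ Fintype.piFinset fun v => if v ∈ S then Finset.Icc 1 k else {0} |
    ∀ v ∈ S, ∀ w ∈ S, G.Adj v w → f v ≠ f w}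

lemma mem_properColorings {G : SimpleGraph V} {S : Finset V} {k : ℕ} {f : V → ℕ} :
    f ∈ properColorings G S k ↔ (∀ v ∈ S, 1 ≤ f v ∧ f v ≤ k) ∧ (∀ v ∉ S, f v = 0) ∧
      ∀ v ∈ S, ∀ w ∈ S, G.Adj v w → f v ≠ f w := by
  simp only [properColorings, Finset.mem_filter, Fintype.mem_piFinset, ← and_assoc]
  refine and_congr_left fun _ => ⟨fun h => ⟨fun v hv => ?_, fun v hv => ?_⟩, fun h v => ?_⟩
  · simpa [hv] using h v
  · simpa [hv] using h v
  · by_cases hv : v ∈ S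
    · simpa [hv] using h.1 v hv
    · simpa [hv] using h.2 v hv

lemma card_properColorings_univ (G : SimpleGraph V) (k : ℕ) :
    (properColorings G Finset.univ k).card = Nat.card (G.Coloring (Fin k)) := by
  classical
  rw [Nat.card_eq_fintype_card, ← Finset.card_univ]
  refine Finset.card_bij' (fun f hf => SimpleGraph.Coloring.mk
      (fun v => (⟨f v - 1, ?_⟩ : Fin k)) ?_) (fun C _ v => (C v : ℕ) + 1) ?_ ?_ ?_ ?_
  · have := (mem_properColorings.1 hf).1 v (Finset.mem_univ v)
    omega
  · intro v w hvw h
    obtain ⟨h1, -, h2⟩ := mem_properColorings.1 hf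
    have a := h1 v (Finset.mem_univ v)
    have b := h1 w (Finset.mem_univ w)
    have c := h2 v (Finset.mem_univ v) w (Finset.mem_univ w) hvw
    simp only [Fin.mk.injEq] at h
    omega
  · simp
  · intro C _
    refine mem_properColorings.2 ⟨fun v _ => ⟨by omega, by have := (C v).2; omega⟩,
      by simp, fun v _ w _ hvw h => C.valid hvw (Fin.ext (by omega))⟩
  · intro f hf
    funext v
    have := (mem_properColorings.1 hf).1 v (Finset.mem_univ v)
    change f v - 1 + 1 = f v
    omega
  · intro C _
    ext v
    change (C v : ℕ) + 1 - 1 = C v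
    omega

/-- The indicator of the independent sets of `G`. -/
noncomputable def indepIndicator (G : SimpleGraph V) (I : Finset V) : ℝ :=
  open scoped Classical in if ∀ v ∈ I, ∀ w ∈ I, ¬ G.Adj v w then 1 else 0

lemma indepIndicator_empty (G : SimpleGraph V) : indepIndicator G ∅ = 1 := by
  simp [indepIndicator]

lemma indepIndicator_nonneg (G : SimpleGraph V) (I : Finset V) : 0 ≤ indepIndicator G I := by
  unfold indepIndicator
  split_ifs <;> norm_num

lemma card_properColorings_succ (G : SimpleGraph V) (S : Finset V) (k : ℕ) :
    ((properColorings G S (k + 1)).card : ℝ) =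
      ∑ I ∈ S.powerset, indepIndicator G I * (properColorings G (S \ I) k).card := by
  classical
  rw [Finset.card_eq_sum_card_fiberwise (f := fun f => {v ∈ S | f v = k + 1}) (t := S.powerset)
    (fun f _ => Finset.mem_coe.2 (Finset.mem_powerset.2 (Finset.filter_subset _ _)))]
  push_cast
  refine Finset.sum_congr rfl fun I hI => ?_
  rw [Finset.mem_powerset] at hI
  by_cases h : ∀ v ∈ I, ∀ w ∈ I, ¬ G.Adj v w
  · rw [indepIndicator, if_pos h, one_mul, Nat.cast_inj]
    refine Finset.card_bij' (fun f _ v => if v ∈ I then 0 else f v)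
      (fun f _ v => if v ∈ I then k + 1 else f v) ?_ ?_ ?_ ?_
    · intro f hf
      obtain ⟨hf, hfI⟩ := Finset.mem_filter.1 hf
      obtain ⟨h1, h2, h3⟩ := mem_properColorings.1 hf
      have hI' : ∀ v, v ∈ I ↔ v ∈ S ∧ f v = k + 1 := by simp [← hfI]
      refine mem_properColorings.2 ⟨?_, ?_, ?_⟩ <;> grind
    · intro f hf
      obtain ⟨h1, h2, h3⟩ := mem_properColorings.1 hf
      refine Finset.mem_filter.2 ⟨mem_properColorings.2 ⟨?_, ?_, ?_⟩, ?_⟩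
      · grind
      · grind
      · intro v hv w hw hvw
        have := h v
        have := h1 v
        have := h1 w
        grind
      · ext v
        have := h1 v
        grind
    · intro f hf
      obtain ⟨hf, hfI⟩ := Finset.mem_filter.1 hf
      funext v
      have hI' : ∀ v, v ∈ I ↔ v ∈ S ∧ f v = k + 1 := by simp [← hfI]
      grind
    · intro f hf
      obtain ⟨h1, h2, h3⟩ := mem_properColorings.1 hf
      funext v
      grind
  · rw [indepIndicator, if_neg h, zero_mul, Nat.cast_eq_zero, Finset.card_eq_zero,
      Finset.filter_eq_empty_iff]
    intro f hf hfI
    have hI' : ∀ v, v ∈ I ↔ v ∈ S ∧ f v = k + 1 := by simp [← hfI]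
    push Not at h
    obtain ⟨v, hv, w, hw, hvw⟩ := h
    have := (mem_properColorings.1 hf).2.2 v (hI hv) w (hI hw) hvw
    grind

/-- `G` with `v` joined to all larger neighbors of `u`. -/
def joinLaterNeighbors (G : SimpleGraph V) (u v : V) : SimpleGraph V :=
  G ⊔ SimpleGraph.fromRel fun a b => a = v ∧ G.Adj u b ∧ v < b

open scoped Classical in
lemma properColorings_joinLaterNeighbors (G : SimpleGraph V) {S : Finset V} {u v : V}
    (hv : v ∈ (S.erase u).filter (G.Adj u)) (k : ℕ) :
    properColorings (joinLaterNeighbors G u v) (S.erase u) k =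
      {f ∈ properColorings G (S.erase u) k |
        ∀ w ∈ (S.erase u).filter (G.Adj u), v < w → f w ≠ f v} := by
  ext f
  simp only [Finset.mem_filter, mem_properColorings, joinLaterNeighbors, SimpleGraph.sup_adj,
    SimpleGraph.fromRel_adj] at hv ⊢
  constructor
  · rintro ⟨h1, h2, h3⟩
    refine ⟨⟨h1, h2, fun a ha b hb hab => h3 a ha b hb (Or.inl hab)⟩, fun w hw hlt => ?_⟩
    exact (h3 v hv.1 w hw.1 (Or.inr ⟨hlt.ne, Or.inl ⟨rfl, hw.2, hlt⟩⟩)).symm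
  · rintro ⟨⟨h1, h2, h3⟩, h4⟩
    refine ⟨h1, h2, fun a ha b hb hab => ?_⟩
    rcases hab with hab | ⟨-, ⟨rfl, hb', hlt⟩ | ⟨rfl, ha', hlt⟩⟩
    · exact h3 a ha b hb hab
    · exact (h4 b ⟨hb, hb'⟩ hlt).symm
    · exact h4 a ⟨ha, ha'⟩ hlt

open scoped Classical in
lemma card_properColorings_erase (G : SimpleGraph V) {S : Finset V} {u : V} (hu : u ∈ S)
    (k : ℕ) :
    (properColorings G S k).card + ∑ v ∈ (S.erase u).filter (G.Adj u),
        (properColorings (joinLaterNeighbors G u v) (S.erase u) k).card =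
      k * (properColorings G (S.erase u) k).card := by
  set N := (S.erase u).filter (G.Adj u) with hN
  have hmem : ∀ w, w ∈ N ↔ (w ≠ u ∧ w ∈ S) ∧ G.Adj u w := by simp [hN]
  have hfib : ∀ f ∈ properColorings G (S.erase u) k,
      {g ∈ properColorings G S k | Function.update g u 0 = f}.card =
        (Finset.Icc 1 k \ N.image f).card := by
    intro f hf
    obtain ⟨h1, h2, h3⟩ := mem_properColorings.1 hf
    have hfu : f u = 0 := h2 u (by simp)
    refine Finset.card_bij' (fun (g : V → ℕ) _ => g u)
      (fun (c : ℕ) _ => (Function.update f u c : V → ℕ)) ?_ ?_ ?_ ?_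
    · intro g hg
      rw [Finset.mem_filter] at hg
      obtain ⟨hg, rfl⟩ := hg
      obtain ⟨g1, g2, g3⟩ := mem_properColorings.1 hg
      simp only [Finset.mem_sdiff, Finset.mem_Icc, Finset.mem_image, not_exists, not_and]
      refine ⟨g1 u hu, fun w hw h => ?_⟩
      have hw' := (hmem w).1 hw
      rw [Function.update_of_ne hw'.1.1] at h
      exact g3 u hu w hw'.1.2 hw'.2 h.symm
    · intro c hc
      simp only [Finset.mem_sdiff, Finset.mem_Icc, Finset.mem_image, not_exists, not_and] at hc
      refine Finset.mem_filter.2 ⟨mem_properColorings.2 ⟨fun v hv => ?_, fun v hv => ?_,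
        fun v hv w hw hvw => ?_⟩, ?_⟩
      · by_cases h : v = u
        · subst h; simpa using hc.1
        · rw [Function.update_of_ne h]; exact h1 v (by simp [h, hv])
      · have h : v ≠ u := by rintro rfl; exact hv hu
        rw [Function.update_of_ne h]; exact h2 v (by simp [hv])
      · by_cases h : v = u
        · subst h
          rw [Function.update_self, Function.update_of_ne hvw.ne']
          exact fun h => hc.2 w ((hmem w).2 ⟨⟨hvw.ne', hw⟩, hvw⟩) h.symm
        · by_cases h' : w = u
          · subst h'
            rw [Function.update_self, Function.update_of_ne h]
            exact hc.2 v ((hmem v).2 ⟨⟨h, hv⟩, hvw.symm⟩)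
          · rw [Function.update_of_ne h, Function.update_of_ne h']
            exact h3 v (by simp [h, hv]) w (by simp [h', hw]) hvw
      · rw [Function.update_idem, ← hfu, Function.update_eq_self]
    · intro g hg
      obtain ⟨hg, rfl⟩ := Finset.mem_filter.1 hg
      simp
    · intro c hc
      simp
  rw [Finset.card_eq_sum_card_fiberwise (f := fun f : V → ℕ => Function.update f u 0)
    (t := properColorings G (S.erase u) k)]
  · have hjoin : ∀ v ∈ N, (properColorings (joinLaterNeighbors G u v) (S.erase u) k).card =
        ∑ f ∈ properColorings G (S.erase u) k, if ∀ w ∈ N, v < w → f w ≠ f v then 1 else 0 :=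
      fun v hv => by rw [properColorings_joinLaterNeighbors G hv, Finset.card_filter]
    rw [Finset.sum_congr rfl hfib, Finset.sum_congr rfl hjoin, Finset.sum_comm,
      ← Finset.sum_add_distrib, mul_comm, ← smul_eq_mul, ← Finset.sum_const]
    refine Finset.sum_congr rfl fun f hf => ?_
    have hsub : N.image f ⊆ Finset.Icc 1 k := by
      intro c hc
      obtain ⟨w, hw, rfl⟩ := Finset.mem_image.1 hc
      exact Finset.mem_Icc.2 ((mem_properColorings.1 hf).1 w (Finset.mem_filter.1 hw).1)
    rw [← Finset.card_filter, card_filter_last_eq_card_image, Finset.card_sdiff_of_subset hsub,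
      Nat.sub_add_cancel (Finset.card_le_card hsub), Nat.card_Icc, Nat.add_sub_cancel]
  · intro g hg
    obtain ⟨g1, g2, g3⟩ := mem_properColorings.1 hg
    refine mem_properColorings.2 ⟨fun v hv => ?_, fun v hv => ?_, fun v hv w hw hvw => ?_⟩
    · rw [Finset.mem_erase] at hv
      simpa [hv.1] using g1 v hv.2
    · by_cases h : v = u
      · subst h; simp
      · simpa [h] using g2 v (by simpa [h] using hv)
    · rw [Finset.mem_erase] at hv hw
      simpa [hv.1, hw.1] using g3 v hv.2 w hw.2 hvw

lemma properColorings_empty (G : SimpleGraph V) (k : ℕ) :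
    (properColorings G ∅ k).card = 1 := by
  rw [Finset.card_eq_one]
  refine ⟨0, ?_⟩
  ext f
  rw [mem_properColorings]
  simp [funext_iff]

lemma exists_chromPoly (S : Finset V) : ∀ G : SimpleGraph V, ∃ p : ℝ[X], ∀ k : ℕ,
    p.eval (k : ℝ) = ((properColorings G S k).card : ℝ) := by
  classical
  induction S using Finset.strongInduction with
  | H S ih =>
    intro G
    rcases S.eq_empty_or_nonempty with rfl | ⟨u, hu⟩
    · exact ⟨1, fun k => by simp [properColorings_empty]⟩
    · choose p hp using ih _ (Finset.erase_ssubset hu)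
      refine ⟨X * p G - ∑ v ∈ (S.erase u).filter (G.Adj u), p (joinLaterNeighbors G u v),
        fun k => ?_⟩
      have h := card_properColorings_erase G hu k
      have h' : ((properColorings G S k).card : ℝ) + ∑ v ∈ (S.erase u).filter (G.Adj u),
          ((properColorings (joinLaterNeighbors G u v) (S.erase u) k).card : ℝ) =
          k * (properColorings G (S.erase u) k).card := by exact_mod_cast h
      simp only [eval_sub, eval_mul, eval_X, eval_finsetSum, hp]
      linarith

/-- The chromatic polynomial of the induced subgraph `G[S]`. -/
noncomputable def chromPoly (G : SimpleGraph V) (S : Finset V) : ℝ[X] :=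
  (exists_chromPoly S G).choose

lemma eval_chromPoly_natCast (G : SimpleGraph V) (S : Finset V) (k : ℕ) :
    (chromPoly G S).eval (k : ℝ) = (properColorings G S k).card :=
  (exists_chromPoly S G).choose_spec k

lemma IsChromPoly.eq_chromPoly {G : SimpleGraph V} {P : ℝ[X]} (hP : IsChromPoly G P) :
    P = chromPoly G Finset.univ :=
  Polynomial.eq_of_eval_natCast_eq fun k => by
    rw [hP k, eval_chromPoly_natCast, card_properColorings_univ]

lemma chromPoly_empty (G : SimpleGraph V) : chromPoly G ∅ = 1 :=
  Polynomial.eq_of_eval_natCast_eq fun k => by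
    simp [eval_chromPoly_natCast, properColorings_empty]

open scoped Classical in
lemma chromPoly_erase (G : SimpleGraph V) {S : Finset V} {u : V} (hu : u ∈ S) :
    chromPoly G S = X * chromPoly G (S.erase u) -
      ∑ v ∈ (S.erase u).filter (G.Adj u), chromPoly (joinLaterNeighbors G u v) (S.erase u) :=
  Polynomial.eq_of_eval_natCast_eq fun k => by
    have h := congrArg (Nat.cast (R := ℝ)) (card_properColorings_erase G hu k)
    push_cast at h
    simp only [eval_sub, eval_mul, eval_X, eval_finsetSum, eval_chromPoly_natCast]
    linarith

lemma eval_chromPoly_add_one (G : SimpleGraph V) (S : Finset V) (x : ℝ) :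
    (chromPoly G S).eval (x + 1) =
      ∑ I ∈ S.powerset, indepIndicator G I * (chromPoly G (S \ I)).eval x := by
  have h : (chromPoly G S).comp (X + 1) =
      ∑ I ∈ S.powerset, C (indepIndicator G I) * chromPoly G (S \ I) :=
    Polynomial.eq_of_eval_natCast_eq fun k => by
      have := card_properColorings_succ G S k
      rw [← eval_chromPoly_natCast] at this
      simp only [eval_comp, eval_add, eval_X, eval_one, eval_finsetSum, eval_mul, eval_C,
        eval_chromPoly_natCast]
      exact_mod_cast this
  simpa [eval_finsetSum] using congrArg (Polynomial.eval x) h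

lemma eval_chromPoly_zero (G : SimpleGraph V) {S : Finset V} (hS : S.Nonempty) :
    (chromPoly G S).eval 0 = 0 := by
  obtain ⟨v, hv⟩ := hS
  have h := eval_chromPoly_natCast G S 0
  rw [Nat.cast_zero] at h
  rw [h, Nat.cast_eq_zero, Finset.card_eq_zero, Finset.eq_empty_iff_forall_notMem]
  intro f hf
  have := (mem_properColorings.1 hf).1 v hv
  omega

/-- The chromatic polynomials of the induced subgraphs, evaluated at `x`. -/
noncomputable def chromVal (G : SimpleGraph V) (x : ℝ) (S : Finset V) : ℝ :=
  (chromPoly G S).eval x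

lemma chromVal_empty (G : SimpleGraph V) (x : ℝ) : chromVal G x ∅ = 1 := by
  simp [chromVal, chromPoly_empty]

lemma chromVal_add_one (G : SimpleGraph V) (x : ℝ) :
    chromVal G (x + 1) = subsetConv (indepIndicator G) (chromVal G x) :=
  funext fun S => eval_chromPoly_add_one G S x

lemma chromVal_zero (G : SimpleGraph V) {S : Finset V} (hS : S.Nonempty) :
    chromVal G 0 S = 0 :=
  eval_chromPoly_zero G hS

lemma subsetConv_chromVal_zero (G : SimpleGraph V) (f : Finset V → ℝ) :
    subsetConv (chromVal G 0) f = f := by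
  funext S
  rw [subsetConv, Finset.sum_eq_single ∅]
  · simp [chromVal_empty]
  · intro T _ hT
    rw [chromVal_zero G (Finset.nonempty_iff_ne_empty.2 hT), zero_mul]
  · simp

lemma subsetConv_indepIndicator_neg_one (G : SimpleGraph V) :
    subsetConv (indepIndicator G) (chromVal G (-1)) = chromVal G 0 := by
  rw [← chromVal_add_one, neg_add_cancel]

lemma subsetConv_neg_one (G : SimpleGraph V) (x : ℝ) :
    subsetConv (chromVal G (-1)) (chromVal G x) = chromVal G (x - 1) := by
  have h : chromVal G x = subsetConv (indepIndicator G) (chromVal G (x - 1)) := by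
    rw [← chromVal_add_one, sub_add_cancel]
  rw [h, ← subsetConv_assoc, subsetConv_comm (chromVal G (-1)),
    subsetConv_indepIndicator_neg_one, subsetConv_chromVal_zero]

lemma rooted_chromVal_natCast (G : SimpleGraph V) (v : V) (k : ℕ) :
    rooted v (chromVal G (k + 1)) =
      ((k : ℝ) + 1) • subsetConv (rooted v (indepIndicator G)) (chromVal G k) := by
  induction k with
  | zero =>
    rw [chromVal_add_one, Nat.cast_zero, subsetConv_comm, subsetConv_chromVal_zero,
      subsetConv_comm, subsetConv_chromVal_zero, zero_add, one_smul]
  | succ k ih =>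
    rw [chromVal_add_one, rooted_subsetConv, Nat.cast_succ, ih, subsetConv_smul,
      ← subsetConv_assoc, subsetConv_comm (indepIndicator G), subsetConv_assoc,
      ← chromVal_add_one, add_smul ((k : ℝ) + 1) (1 : ℝ), one_smul, add_comm]

lemma chromPoly_eq_X_mul (G : SimpleGraph V) {S : Finset V} {v : V} (hv : v ∈ S) :
    chromPoly G S = X * ∑ I ∈ S.powerset, C (rooted v (indepIndicator G) I) *
      (chromPoly G (S \ I)).comp (X - 1) :=
  Polynomial.eq_of_eval_natCast_eq fun k => by
    cases k with
    | zero => simp [eval_chromPoly_zero G ⟨v, hv⟩]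
    | succ k =>
      have := congrFun (rooted_chromVal_natCast G v k) S
      rw [rooted, if_pos hv] at this
      simpa [eval_finsetSum, subsetConv, chromVal] using this

lemma chromVal_eq_mul_subsetConv (G : SimpleGraph V) {S : Finset V} {v : V} (hv : v ∈ S)
    (x : ℝ) : chromVal G x S =
      x * subsetConv (rooted v (indepIndicator G)) (chromVal G (x - 1)) S := by
  rw [chromVal, chromPoly_eq_X_mul G hv]
  simp [eval_finsetSum, subsetConv, chromVal]

/-- The linear coefficients of the chromatic polynomials of the induced subgraphs. -/
noncomputable def linCoeff (G : SimpleGraph V) (S : Finset V) : ℝ :=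
  (chromPoly G S).coeff 1

lemma rooted_linCoeff (G : SimpleGraph V) (v : V) :
    rooted v (linCoeff G) = subsetConv (rooted v (indepIndicator G)) (chromVal G (-1)) := by
  funext S
  by_cases hv : v ∈ S
  · rw [rooted, if_pos hv, linCoeff, chromPoly_eq_X_mul G hv, coeff_X_mul, coeff_zero_eq_eval_zero]
    simp [eval_finsetSum, subsetConv, chromVal]
  · rw [subsetConv_rooted_of_notMem hv, rooted, if_neg hv]

lemma chromVal_eq_mul_subsetConv_linCoeff (G : SimpleGraph V) {S : Finset V} {v : V}
    (hv : v ∈ S) (x : ℝ) :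
    chromVal G x S = x * subsetConv (rooted v (linCoeff G)) (chromVal G x) S := by
  rw [rooted_linCoeff, subsetConv_assoc, subsetConv_neg_one, ← chromVal_eq_mul_subsetConv G hv]

/-- The number of acyclic orientations of `G[S]` all of whose sources lie in `X`, by
inclusion-exclusion over the sets of sources outside `X`. -/
noncomputable def sourceCount (G : SimpleGraph V) (S X : Finset V) : ℝ :=
  (-1) ^ S.card * ∑ I ∈ S.powerset,
    if Disjoint I X then indepIndicator G I * chromVal G (-1) (S \ I) else 0

lemma sourceCount_empty (G : SimpleGraph V) (X : Finset V) : sourceCount G ∅ X = 1 := by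
  simp [sourceCount, indepIndicator_empty, chromVal_empty]

lemma indepIndicator_mul_ite (G : SimpleGraph V) {I K : Finset V} (h : I ⊆ K) :
    indepIndicator G I * (if Disjoint (K \ I) (neighbors G I) then indepIndicator G (K \ I)
      else 0) = indepIndicator G K := by
  classical
  by_cases hK : ∀ v ∈ K, ∀ w ∈ K, ¬ G.Adj v w
  · have h1 : ∀ v ∈ I, ∀ w ∈ I, ¬ G.Adj v w := fun v hv w hw => hK v (h hv) w (h hw)
    have h2 : ∀ v ∈ K \ I, ∀ w ∈ K \ I, ¬ G.Adj v w := fun v hv w hw =>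
      hK v (Finset.sdiff_subset hv) w (Finset.sdiff_subset hw)
    have h3 : Disjoint (K \ I) (neighbors G I) := by
      rw [Finset.disjoint_left]
      intro w hw hw'
      obtain ⟨v, hv, hvw⟩ := mem_neighbors.1 hw'
      exact hK v (h hv) w (Finset.sdiff_subset hw) hvw
    simp only [indepIndicator, if_pos hK, if_pos h1, if_pos h2, if_pos h3, one_mul]
  · rw [indepIndicator, indepIndicator, indepIndicator, if_neg hK]
    split_ifs with h1 h2 h3 <;> try simp
    refine hK fun v hv w hw hvw => ?_
    rw [Finset.disjoint_left] at h2
    by_cases hvI : v ∈ I <;> by_cases hwI : w ∈ I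
    · exact h1 v hvI w hwI hvw
    · exact h2 (Finset.mem_sdiff.2 ⟨hw, hwI⟩)
        (mem_neighbors.2 ⟨v, hvI, hvw⟩)
    · exact h2 (Finset.mem_sdiff.2 ⟨hv, hvI⟩)
        (mem_neighbors.2 ⟨w, hwI, hvw.symm⟩)
    · exact h3 v (Finset.mem_sdiff.2 ⟨hv, hvI⟩) w (Finset.mem_sdiff.2 ⟨hw, hwI⟩) hvw

lemma sourceCount_eq_sum (G : SimpleGraph V) {S : Finset V} (hS : S.Nonempty) (X : Finset V) :
    sourceCount G S X = ∑ I ∈ S.powerset, if I.Nonempty ∧ I ⊆ X then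
      indepIndicator G I * sourceCount G (S \ I) (neighbors G I) else 0 := by
  have hz : ∑ I ∈ S.powerset, indepIndicator G I * chromVal G (-1) (S \ I) = 0 :=
    (congrFun (subsetConv_indepIndicator_neg_one G) S).trans (chromVal_zero G hS)
  have key := sum_powerset_sum_powerset_sdiff (fun I J => (-1 : ℝ) ^ S.card *
    chromVal G (-1) (S \ (I ∪ J)) * (indepIndicator G I *
      (if Disjoint J (neighbors G I) then indepIndicator G J else 0)) *
      (if I.Nonempty ∧ I ⊆ X then (-1 : ℝ) ^ I.card else 0)) S
  have hR : ∀ K ∈ S.powerset, (∑ I ∈ K.powerset, ((-1 : ℝ) ^ S.card *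
      chromVal G (-1) (S \ (I ∪ (K \ I))) * (indepIndicator G I *
      (if Disjoint (K \ I) (neighbors G I) then indepIndicator G (K \ I) else 0)) *
      (if I.Nonempty ∧ I ⊆ X then (-1 : ℝ) ^ I.card else 0))) =
      (-1 : ℝ) ^ S.card * (if Disjoint K X then
        indepIndicator G K * chromVal G (-1) (S \ K) else 0) -
      (-1 : ℝ) ^ S.card * (indepIndicator G K * chromVal G (-1) (S \ K)) := by
    intro K _
    have : ∀ I ∈ K.powerset, ((-1 : ℝ) ^ S.card *
        chromVal G (-1) (S \ (I ∪ (K \ I))) * (indepIndicator G I *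
        (if Disjoint (K \ I) (neighbors G I) then indepIndicator G (K \ I) else 0)) *
        (if I.Nonempty ∧ I ⊆ X then (-1 : ℝ) ^ I.card else 0)) =
        (-1 : ℝ) ^ S.card * chromVal G (-1) (S \ K) * indepIndicator G K *
        (if I.Nonempty ∧ I ⊆ X then (-1 : ℝ) ^ I.card else 0) := by
      intro I hI
      rw [Finset.mem_powerset] at hI
      rw [indepIndicator_mul_ite G hI, Finset.union_sdiff_of_subset hI]
    rw [Finset.sum_congr rfl this, ← Finset.mul_sum, sum_powerset_nonempty_subset_neg_one_pow]
    split_ifs <;> ring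
  rw [Finset.sum_congr rfl hR, Finset.sum_sub_distrib, ← Finset.mul_sum, ← Finset.mul_sum, hz,
    mul_zero, sub_zero] at key
  rw [sourceCount, ← key]
  refine Finset.sum_congr rfl fun I hI => ?_
  rw [Finset.mem_powerset] at hI
  split_ifs with h
  · have hpow : (-1 : ℝ) ^ S.card = (-1) ^ (S \ I).card * (-1) ^ I.card := by
      rw [← pow_add, Finset.card_sdiff_add_card_eq_card hI]
    have hsq : (-1 : ℝ) ^ I.card * (-1) ^ I.card = 1 := by
      rw [← mul_pow]; norm_num
    rw [sourceCount, Finset.mul_sum, Finset.mul_sum]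
    refine Finset.sum_congr rfl fun J _ => ?_
    rw [hpow, sdiff_sdiff_left, Finset.sup_eq_union]
    split_ifs
    · linear_combination ((-1) ^ (S \ I).card * chromVal G (-1) (S \ (I ∪ J)) *
        (indepIndicator G I * indepIndicator G J)) * hsq
    · ring
  · simp

lemma sourceCount_nonneg (G : SimpleGraph V) (S : Finset V) :
    ∀ X, 0 ≤ sourceCount G S X := by
  induction S using Finset.strongInduction with
  | H S ih =>
    intro X
    rcases S.eq_empty_or_nonempty with rfl | hS
    · rw [sourceCount_empty]; exact zero_le_one
    · rw [sourceCount_eq_sum G hS]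
      refine Finset.sum_nonneg fun I hI => ?_
      split_ifs with h
      · exact mul_nonneg (indepIndicator_nonneg G I)
          (ih _ (Finset.sdiff_ssubset (Finset.mem_powerset.1 hI) h.1) _)
      · exact le_rfl

lemma sourceCount_eq_zero (G : SimpleGraph V) {S X : Finset V} (hS : S.Nonempty)
    (h : Disjoint S X) : sourceCount G S X = 0 := by
  rw [sourceCount_eq_sum G hS]
  refine Finset.sum_eq_zero fun I hI => if_neg ?_
  rintro ⟨⟨v, hv⟩, hIX⟩
  exact Finset.disjoint_left.1 h (Finset.mem_powerset.1 hI hv) (hIX hv)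

lemma sourceCount_eq_one (G : SimpleGraph V) {S X : Finset V}
    (h : ∀ v ∈ S, ∀ w ∈ S, ¬ G.Adj v w) (hX : S ⊆ X) : sourceCount G S X = 1 := by
  rcases S.eq_empty_or_nonempty with rfl | hS
  · exact sourceCount_empty G X
  rw [sourceCount_eq_sum G hS, Finset.sum_eq_single S]
  · rw [if_pos ⟨hS, hX⟩, sdiff_self, Finset.bot_eq_empty, sourceCount_empty, mul_one,
      indepIndicator, if_pos h]
  · intro I hI hne
    rw [Finset.mem_powerset] at hI
    rw [sourceCount_eq_zero, mul_zero, ite_self]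
    · exact Finset.sdiff_nonempty.2 fun h' => hne (hI.antisymm h')
    · rw [Finset.disjoint_left]
      intro w hw hw'
      obtain ⟨v, hv, hvw⟩ := mem_neighbors.1 hw'
      exact h v (hI hv) w (Finset.sdiff_subset hw) hvw
  · simp

lemma sourceCount_le_sum_erase (G : SimpleGraph V) (S : Finset V) :
    S.Nonempty → ∀ X, sourceCount G S X ≤ ∑ w ∈ S, sourceCount G (S.erase w) X := by
  induction S using Finset.strongInduction with
  | H S ih =>
    intro hS X
    by_cases hind : (∀ v ∈ S, ∀ w ∈ S, ¬ G.Adj v w) ∧ S ⊆ X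
    · obtain ⟨w, hw⟩ := hS
      rw [sourceCount_eq_one G hind.1 hind.2, ← sourceCount_eq_one G (S := S.erase w) (X := X)
        (fun a ha b hb => hind.1 a (Finset.mem_of_mem_erase ha) b (Finset.mem_of_mem_erase hb))
        ((Finset.erase_subset _ _).trans hind.2)]
      exact Finset.single_le_sum (f := fun w => sourceCount G (S.erase w) X)
        (fun w _ => sourceCount_nonneg G _ X) hw
    · set φ : Finset V → ℝ := fun I =>
        if I.Nonempty ∧ I ⊆ X then indepIndicator G I else 0 with hφ
      have hφ0 : ∀ I, 0 ≤ φ I := fun I => by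
        simp only [hφ]
        split_ifs
        exacts [indepIndicator_nonneg G I, le_rfl]
      have hrec : ∀ T : Finset V, (∑ I ∈ T.powerset,
          if I.Nonempty ∧ I ⊆ X then indepIndicator G I *
            sourceCount G (T \ I) (neighbors G I) else 0) =
          ∑ I ∈ T.powerset, φ I * sourceCount G (T \ I) (neighbors G I) := fun T => by
        refine Finset.sum_congr rfl fun I _ => ?_
        simp only [hφ]
        split_ifs <;> simp
      have hφS : φ S = 0 := by
        simp only [hφ, indepIndicator]
        split_ifs with h1 h2
        · exact absurd ⟨h2, h1.2⟩ hind
        all_goals rfl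
      calc sourceCount G S X
          = ∑ I ∈ S.powerset, φ I * sourceCount G (S \ I) (neighbors G I) := by
            rw [sourceCount_eq_sum G hS, hrec]
        _ ≤ ∑ I ∈ S.powerset, ∑ w ∈ S \ I,
              φ I * sourceCount G ((S.erase w) \ I) (neighbors G I) := by
            refine Finset.sum_le_sum fun I hI => ?_
            rw [Finset.mem_powerset] at hI
            rw [← Finset.mul_sum]
            by_cases hIS : I = S
            · simp [hIS, hφS]
            rcases I.eq_empty_or_nonempty with rfl | hne
            · simp [hφ]
            refine mul_le_mul_of_nonneg_left ?_ (hφ0 I)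
            refine (ih _ (Finset.sdiff_ssubset hI hne)
              (Finset.sdiff_nonempty.2 fun h => hIS (hI.antisymm h)) _).trans_eq ?_
            refine Finset.sum_congr rfl fun w _ => ?_
            rw [Finset.erase_sdiff_comm]
        _ = ∑ w ∈ S, ∑ I ∈ (S.erase w).powerset,
              φ I * sourceCount G ((S.erase w) \ I) (neighbors G I) := by
            refine Finset.sum_comm' fun I w => ?_
            simp only [Finset.mem_powerset, Finset.mem_sdiff]
            grind
        _ ≤ _ := by
            refine Finset.sum_le_sum fun w _ => ?_
            rcases (S.erase w).eq_empty_or_nonempty with h | h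
            · rw [h]
              simp [hφ, sourceCount_empty]
            · rw [sourceCount_eq_sum G h, hrec]

/-- The absolute value of the linear coefficient of the chromatic polynomial of `G[S]`. -/
noncomputable def absLinCoeff (G : SimpleGraph V) (S : Finset V) : ℝ :=
  (-1) ^ (S.card + 1) * linCoeff G S

lemma absLinCoeff_eq_sourceCount (G : SimpleGraph V) {S : Finset V} {v : V} (hv : v ∈ S) :
    absLinCoeff G S = sourceCount G S {v} := by
  have h1 : ∑ I ∈ S.powerset, indepIndicator G I * chromVal G (-1) (S \ I) = 0 :=
    (congrFun (subsetConv_indepIndicator_neg_one G) S).trans (chromVal_zero G ⟨v, hv⟩)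
  have h2 : linCoeff G S =
      ∑ I ∈ S.powerset, rooted v (indepIndicator G) I * chromVal G (-1) (S \ I) := by
    have := congrFun (rooted_linCoeff G v) S
    rwa [rooted, if_pos hv] at this
  have h3 : (∑ I ∈ S.powerset, if Disjoint I {v} then
      indepIndicator G I * chromVal G (-1) (S \ I) else 0) + linCoeff G S = 0 := by
    rw [h2, ← Finset.sum_add_distrib]
    refine Eq.trans ?_ h1
    refine Finset.sum_congr rfl fun I _ => ?_
    by_cases h : v ∈ I <;> simp [rooted, h]
  rw [absLinCoeff, sourceCount, pow_succ]
  linear_combination (-1) ^ S.card * (-h3)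

lemma absLinCoeff_nonneg (G : SimpleGraph V) {S : Finset V} (hS : S.Nonempty) :
    0 ≤ absLinCoeff G S := by
  obtain ⟨v, hv⟩ := hS
  rw [absLinCoeff_eq_sourceCount G hv]
  exact sourceCount_nonneg G S {v}

lemma absLinCoeff_singleton (G : SimpleGraph V) (v : V) : absLinCoeff G {v} = 1 := by
  rw [absLinCoeff_eq_sourceCount G (Finset.mem_singleton_self v)]
  exact sourceCount_eq_one G (by simp) le_rfl

lemma card_mul_absLinCoeff_le (G : SimpleGraph V) {S : Finset V} (hS : 2 ≤ S.card) :
    (S.card : ℝ) * absLinCoeff G S ≤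
      ((S.card : ℝ) - 1) * ∑ w ∈ S, absLinCoeff G (S.erase w) := by
  have hne : S.Nonempty := Finset.card_pos.1 (by omega)
  have hcard : ∀ w ∈ S, ((S.erase w).card : ℝ) = S.card - 1 := fun w hw => by
    rw [Finset.card_erase_of_mem hw, Nat.cast_sub (by omega), Nat.cast_one]
  calc (S.card : ℝ) * absLinCoeff G S = ∑ v ∈ S, sourceCount G S {v} := by
        rw [← nsmul_eq_mul, ← Finset.sum_const]
        exact Finset.sum_congr rfl fun v hv => absLinCoeff_eq_sourceCount G hv
    _ ≤ ∑ v ∈ S, ∑ w ∈ S, sourceCount G (S.erase w) {v} :=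
        Finset.sum_le_sum fun v _ => sourceCount_le_sum_erase G S hne {v}
    _ = ∑ w ∈ S, ∑ v ∈ S, sourceCount G (S.erase w) {v} := Finset.sum_comm
    _ = ∑ w ∈ S, ∑ v ∈ S.erase w, absLinCoeff G (S.erase w) := by
        refine Finset.sum_congr rfl fun w hw => ?_
        have hpos : (S.erase w).Nonempty := by
          rw [← Finset.card_pos, Finset.card_erase_of_mem hw]; omega
        rw [← Finset.sum_erase_add _ _ hw, sourceCount_eq_zero G hpos (by simp), add_zero]
        exact Finset.sum_congr rfl fun v hv => (absLinCoeff_eq_sourceCount G hv).symm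
    _ = _ := by
        rw [Finset.mul_sum]
        refine Finset.sum_congr rfl fun w hw => ?_
        rw [Finset.sum_const, nsmul_eq_mul, hcard w hw]

/-- The chromatic polynomial of `G[S]` at `-X`, with the sign that makes its coefficients
nonnegative. -/
noncomputable def altPoly (G : SimpleGraph V) (S : Finset V) : ℝ[X] :=
  C ((-1) ^ S.card) * (chromPoly G S).comp (-X)

lemma altPoly_empty (G : SimpleGraph V) : altPoly G ∅ = 1 := by
  simp [altPoly, chromPoly_empty]

lemma eval_altPoly (G : SimpleGraph V) (S : Finset V) (t : ℝ) :
    (altPoly G S).eval t = (-1) ^ S.card * chromVal G (-t) S := by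
  simp [altPoly, chromVal]

lemma eval_altPoly_eq_mul_sum (G : SimpleGraph V) {S : Finset V} {v : V} (hv : v ∈ S) (t : ℝ) :
    (altPoly G S).eval t =
      t * ∑ T ∈ S.powerset, if v ∈ T then absLinCoeff G T * (altPoly G (S \ T)).eval t else 0 := by
  rw [eval_altPoly, chromVal_eq_mul_subsetConv_linCoeff G hv, subsetConv, Finset.mul_sum,
    Finset.mul_sum, Finset.mul_sum]
  refine Finset.sum_congr rfl fun T hT => ?_
  rw [Finset.mem_powerset] at hT
  unfold rooted
  split_ifs
  · rw [eval_altPoly, absLinCoeff, ← Finset.card_sdiff_add_card_eq_card hT, pow_add, pow_succ]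
    ring
  · simp

lemma card_mul_eval_altPoly (G : SimpleGraph V) (S : Finset V) (t : ℝ) :
    (S.card : ℝ) * (altPoly G S).eval t =
      t * ∑ T ∈ S.powerset, (T.card : ℝ) * (absLinCoeff G T * (altPoly G (S \ T)).eval t) := by
  rw [← nsmul_eq_mul, ← Finset.sum_const,
    Finset.sum_congr rfl fun v hv => eval_altPoly_eq_mul_sum G hv t, ← Finset.mul_sum,
    Finset.sum_comm]
  refine congrArg _ (Finset.sum_congr rfl fun T hT => ?_)
  rw [← Finset.sum_filter, Finset.filter_mem_eq_inter,
    Finset.inter_eq_right.2 (Finset.mem_powerset.1 hT), Finset.sum_const, nsmul_eq_mul]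

lemma eval_altPoly_pos (G : SimpleGraph V) {t : ℝ} (ht : 0 < t) (S : Finset V) :
    0 < (altPoly G S).eval t := by
  induction S using Finset.strongInduction with
  | H S ih =>
    rcases S.eq_empty_or_nonempty with rfl | ⟨v, hv⟩
    · simp [altPoly_empty]
    · rw [eval_altPoly_eq_mul_sum G hv]
      refine mul_pos ht (Finset.sum_pos' (fun T hT => ?_)
        ⟨{v}, by simpa using hv, ?_⟩)
      · split_ifs with h
        · exact mul_nonneg (absLinCoeff_nonneg G ⟨v, h⟩)
            (ih _ (Finset.sdiff_ssubset (Finset.mem_powerset.1 hT) ⟨v, h⟩)).le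
        · exact le_rfl
      · rw [if_pos (Finset.mem_singleton_self v), absLinCoeff_singleton, one_mul]
        exact ih _ (Finset.sdiff_ssubset (by simpa using hv) (Finset.singleton_nonempty v))

lemma card_mul_eval_altPoly_le (G : SimpleGraph V) {t : ℝ} (ht : 0 < t) (S : Finset V) :
    (S.card : ℝ) * (altPoly G S).eval t ≤
      (t + S.card - 1) * ∑ u ∈ S, (altPoly G (S.erase u)).eval t := by
  have hterm : ∀ T ∈ S.powerset, (T.card : ℝ) * (absLinCoeff G T * (altPoly G (S \ T)).eval t) ≤
      (∑ u ∈ S, if T = {u} then (altPoly G (S \ T)).eval t else 0) +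
      ∑ w ∈ T, ((T.erase w).card : ℝ) *
        (absLinCoeff G (T.erase w) * (altPoly G ((S.erase w) \ (T.erase w))).eval t) := by
    intro T hT
    rw [Finset.mem_powerset] at hT
    have hpos := eval_altPoly_pos G ht (S \ T)
    have hsum : 0 ≤ ∑ u ∈ S, if T = {u} then (altPoly G (S \ T)).eval t else 0 :=
      Finset.sum_nonneg fun u _ => by split_ifs; exacts [hpos.le, le_rfl]
    rcases Nat.lt_or_ge T.card 2 with h | h
    · interval_cases hc : T.card
      · rw [Finset.card_eq_zero] at hc
        subst hc
        simp
      · obtain ⟨u, rfl⟩ := Finset.card_eq_one.1 hc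
        have hu : u ∈ S := by simpa using hT
        simp [absLinCoeff_singleton, hu]
    · have hle := mul_le_mul_of_nonneg_right (card_mul_absLinCoeff_le G h) hpos.le
      have heq : ∑ w ∈ T, ((T.erase w).card : ℝ) *
          (absLinCoeff G (T.erase w) * (altPoly G ((S.erase w) \ (T.erase w))).eval t) =
          ((T.card : ℝ) - 1) * (∑ w ∈ T, absLinCoeff G (T.erase w)) *
            (altPoly G (S \ T)).eval t := by
        rw [Finset.mul_sum, Finset.sum_mul]
        refine Finset.sum_congr rfl fun w hw => ?_
        have : (S.erase w) \ (T.erase w) = S \ T := by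
          ext a
          simp only [Finset.mem_sdiff, Finset.mem_erase]
          grind
        rw [this, Finset.card_erase_of_mem hw, Nat.cast_sub (by omega), Nat.cast_one, mul_assoc]
      rw [heq]
      linarith
  have h1 : ∑ T ∈ S.powerset, ∑ u ∈ S, (if T = {u} then (altPoly G (S \ T)).eval t else 0) =
      ∑ u ∈ S, (altPoly G (S.erase u)).eval t := by
    rw [Finset.sum_comm]
    refine Finset.sum_congr rfl fun u hu => ?_
    rw [Finset.sum_ite_eq', if_pos (by simpa using hu), Finset.sdiff_singleton_eq_erase]
  have h2 : t * ∑ T ∈ S.powerset, ∑ w ∈ T, ((T.erase w).card : ℝ) *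
      (absLinCoeff G (T.erase w) * (altPoly G ((S.erase w) \ (T.erase w))).eval t) =
      ((S.card : ℝ) - 1) * ∑ u ∈ S, (altPoly G (S.erase u)).eval t := by
    rw [sum_powerset_sum_mem (fun w T => (T.card : ℝ) *
      (absLinCoeff G T * (altPoly G ((S.erase w) \ T)).eval t)), Finset.mul_sum, Finset.mul_sum]
    refine Finset.sum_congr rfl fun w hw => ?_
    rw [← card_mul_eval_altPoly, Finset.card_erase_of_mem hw,
      Nat.cast_sub (Finset.card_pos.2 ⟨w, hw⟩), Nat.cast_one]
  have h3 := mul_le_mul_of_nonneg_left (Finset.sum_le_sum hterm) ht.le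
  rw [← card_mul_eval_altPoly, Finset.sum_add_distrib, mul_add, h1, h2] at h3
  linarith

open scoped Classical in
lemma altPoly_erase (G : SimpleGraph V) {S : Finset V} {u : V} (hu : u ∈ S) :
    altPoly G S = X * altPoly G (S.erase u) +
      ∑ v ∈ (S.erase u).filter (G.Adj u), altPoly (joinLaterNeighbors G u v) (S.erase u) := by
  simp only [altPoly]
  rw [chromPoly_erase G hu, ← Finset.mul_sum, ← Finset.card_erase_add_one hu, pow_succ]
  simp only [sub_comp, mul_comp, X_comp, C_mul, C_neg, C_1, Polynomial.sum_comp]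
  ring

/-- The numerator of the difference of the logarithmic derivatives of `altPoly G S` and of
the corresponding polynomial of the complete graph. -/
noncomputable def logDerivGap (G : SimpleGraph V) (S : Finset V) (t : ℝ) : ℝ :=
  (derivative (altPoly G S)).eval t -
    (∑ i ∈ Finset.range S.card, 1 / (t + i)) * (altPoly G S).eval t

open scoped Classical in
lemma logDerivGap_erase (G : SimpleGraph V) {S : Finset V} {u : V} (hu : u ∈ S) (t : ℝ) :
    logDerivGap G S t = t * logDerivGap G (S.erase u) t +
      ∑ v ∈ (S.erase u).filter (G.Adj u), logDerivGap (joinLaterNeighbors G u v) (S.erase u) t +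
      ((altPoly G (S.erase u)).eval t - 1 / (t + S.card - 1) * (altPoly G S).eval t) := by
  have hA := congrArg (Polynomial.eval t) (altPoly_erase G hu)
  have hD := congrArg (fun p => (derivative p).eval t) (altPoly_erase G hu)
  simp only [eval_add, eval_mul, eval_X, eval_finsetSum, derivative_add, derivative_mul,
    derivative_X, derivative_sum, one_mul] at hA hD
  have hcard := Finset.card_erase_add_one hu
  have hsum : ∑ i ∈ Finset.range S.card, 1 / (t + i) =
      ∑ i ∈ Finset.range (S.erase u).card, 1 / (t + i) + 1 / (t + S.card - 1) := by
    rw [← hcard, Finset.sum_range_succ]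
    push_cast
    ring
  simp only [logDerivGap, Finset.sum_sub_distrib, ← Finset.mul_sum]
  rw [hsum, hD]
  linear_combination (-(∑ i ∈ Finset.range (S.erase u).card, 1 / (t + (i : ℝ)))) * hA

lemma card_mul_logDerivGap_ge (G : SimpleGraph V) {S : Finset V} (hS : S.Nonempty) {t : ℝ}
    (ht : 0 < t) (h : ∀ u ∈ S, ∀ G' : SimpleGraph V, 0 ≤ logDerivGap G' (S.erase u) t) :
    t * ∑ u ∈ S, logDerivGap G (S.erase u) t ≤ S.card * logDerivGap G S t := by
  classical
  have hpos : 0 < t + S.card - 1 := by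
    have : (1 : ℝ) ≤ S.card := by exact_mod_cast Finset.card_pos.2 hS
    linarith
  have h1 : (S.card : ℝ) * (1 / (t + S.card - 1) * (altPoly G S).eval t) ≤
      ∑ u ∈ S, (altPoly G (S.erase u)).eval t := by
    have := card_mul_eval_altPoly_le G ht S
    rw [mul_left_comm, one_div, inv_mul_le_iff₀ hpos]
    exact this
  have h2 : 0 ≤ ∑ u ∈ S, ∑ v ∈ (S.erase u).filter (G.Adj u),
      logDerivGap (joinLaterNeighbors G u v) (S.erase u) t :=
    Finset.sum_nonneg fun u hu => Finset.sum_nonneg fun v _ => h u hu _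
  have h3 : (S.card : ℝ) * logDerivGap G S t = ∑ u ∈ S, logDerivGap G S t := by
    rw [Finset.sum_const, nsmul_eq_mul]
  rw [h3, Finset.sum_congr rfl fun u hu => logDerivGap_erase G hu t, Finset.sum_add_distrib,
    Finset.sum_add_distrib, Finset.sum_sub_distrib, Finset.sum_const, nsmul_eq_mul,
    ← Finset.mul_sum]
  linarith

lemma logDerivGap_nonneg {t : ℝ} (ht : 0 < t) (S : Finset V) :
    ∀ G : SimpleGraph V, 0 ≤ logDerivGap G S t := by
  induction S using Finset.strongInduction with
  | H S ih =>
    intro G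
    rcases S.eq_empty_or_nonempty with rfl | hS
    · simp [logDerivGap, altPoly_empty]
    · have hle := card_mul_logDerivGap_ge G hS ht fun u hu => ih _ (Finset.erase_ssubset hu)
      have h0 : 0 ≤ t * ∑ u ∈ S, logDerivGap G (S.erase u) t :=
        mul_nonneg ht.le (Finset.sum_nonneg fun u hu => ih _ (Finset.erase_ssubset hu) G)
      exact nonneg_of_mul_nonneg_right (h0.trans hle) (by exact_mod_cast Finset.card_pos.2 hS)

lemma logDerivGap_pos {t : ℝ} (ht : 0 < t) (G : SimpleGraph V) {a b : V} (hab : a ≠ b)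
    (hG : ¬ G.Adj a b) (S : Finset V) : a ∈ S → b ∈ S → 0 < logDerivGap G S t := by
  classical
  induction S using Finset.strongInduction with
  | H S ih =>
    intro ha hb
    by_cases h : ∃ u ∈ S, u ≠ a ∧ u ≠ b
    · obtain ⟨u, hu, hua, hub⟩ := h
      have hle := card_mul_logDerivGap_ge G ⟨a, ha⟩ ht fun u _ => logDerivGap_nonneg ht _
      have h0 : 0 < t * ∑ u ∈ S, logDerivGap G (S.erase u) t :=
        mul_pos ht (Finset.sum_pos' (fun u _ => logDerivGap_nonneg ht _ G)
          ⟨u, hu, ih _ (Finset.erase_ssubset hu) (by simp [hua.symm, ha])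
            (by simp [hub.symm, hb])⟩)
      exact pos_of_mul_pos_right (h0.trans_le hle) (Nat.cast_nonneg _)
    · push Not at h
      have hN : (S.erase a).filter (G.Adj a) = ∅ := by
        refine Finset.filter_eq_empty_iff.2 fun w hw => ?_
        rw [Finset.mem_erase] at hw
        rwa [h w hw.2 hw.1]
      have hcard : (2 : ℝ) ≤ S.card := by
        exact_mod_cast Finset.one_lt_card.2 ⟨a, ha, b, hb, hab⟩
      have hA := congrArg (Polynomial.eval t) (altPoly_erase G ha)
      rw [hN, Finset.sum_empty, add_zero, eval_mul, eval_X] at hA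
      have hpos := eval_altPoly_pos G ht (S.erase a)
      have hfrac : 1 / (t + S.card - 1) * t < 1 := by
        rw [one_div_mul_eq_div, div_lt_one (by linarith)]
        linarith
      have := mul_nonneg ht.le (logDerivGap_nonneg ht (S.erase a) G)
      have hlt := mul_lt_mul_of_pos_right hfrac hpos
      rw [logDerivGap_erase G ha, hN, Finset.sum_empty, hA]
      linarith

end ChromaticPolynomial

theorem stmt8 {V : Type*} [Fintype V] (G : SimpleGraph V) (hnc : G ≠ ⊤)
    (P : Polynomial ℝ) (hP : IsChromPoly G P) (x : ℝ) (hx : x < 0) :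
    (Polynomial.derivative P).eval x / P.eval x <
      ∑ i ∈ Finset.range (Fintype.card V), 1 / (x - (i : ℝ)) := by
  let _ : LinearOrder V := LinearOrder.lift' (Fintype.equivFin V) (Fintype.equivFin V).injective
  obtain ⟨a, b, hab, hG⟩ := SimpleGraph.ne_top_iff_exists_not_adj.1 hnc
  have ht : 0 < -x := neg_pos.2 hx
  have hgap := logDerivGap_pos ht G hab hG Finset.univ (Finset.mem_univ a) (Finset.mem_univ b)
  have hpos := eval_altPoly_pos G ht Finset.univ
  have hsum : ∑ i ∈ Finset.range (Fintype.card V), 1 / (x - (i : ℝ)) =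
      -∑ i ∈ Finset.range (Fintype.card V), 1 / (-x + (i : ℝ)) := by
    rw [← Finset.sum_neg_distrib]
    refine Finset.sum_congr rfl fun i _ => ?_
    rw [← one_div_neg_eq_neg_one_div, neg_add, neg_neg, sub_eq_add_neg]
  have hdiv : (derivative P).eval x / P.eval x =
      -((derivative (altPoly G Finset.univ)).eval (-x) /
        (altPoly G Finset.univ).eval (-x)) := by
    have hne : ((-1 : ℝ) ^ (Finset.univ : Finset V).card) ≠ 0 := by simp
    rw [hP.eq_chromPoly, altPoly]
    simp only [derivative_mul, derivative_C, zero_mul, zero_add, derivative_comp, derivative_neg,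
      derivative_X, eval_mul, eval_C, eval_comp, eval_neg, eval_X, neg_neg, eval_one]
    rw [mul_div_mul_left _ _ hne]
    ring
  rw [hsum, hdiv, neg_lt_neg_iff, lt_div_iff₀ hpos]
  rw [logDerivGap, Finset.card_univ] at hgap
  linarith
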